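/- (⟨Cap⟩ ⊗ id_V) ∘ (id_V ⊗ ⟨NE⟩) = (id_V ⊗ ⟨Cap⟩) ∘ (⟨NW⟩ ⊗ id_V) as K-linear maps V ⊗ V ⊗ V → V (identifying K ⊗ V ≅ V ≅ V ⊗ K). This is the Kauffman-amplitude identity corresponding to the time-reversed flavor of the Yetter Ψ move, i.e. the source [0,NW,1][1,Cap,0] and target [1,NE,0][0,Cap,1] of the elementary transition ET4t have equal Kauffman amplitudes. -/

import Mathlib

set_option synthInstance.maxHeartbeats 1000000
set_option maxHeartbeats 1000000

noncomputable section

open TensorProduct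

/-- The ground field `K = ℚ(q)`. -/
abbrev K : Type := RatFunc ℚ

/-- The 2-dimensional `K`-vector space `V` with basis `e 0, e 1`. -/
abbrev V : Type := Fin 2 → K

/-- The indeterminate `q`. -/
noncomputable def q : K := RatFunc.X

/-- The basis vectors `e₀, e₁` of `V`. -/
noncomputable def e : Fin 2 → V := fun i => Pi.single i (1 : K)

/-- The standard basis of `V`. -/
noncomputable def Vbasis : Module.Basis (Fin 2) K V := Pi.basisFun K (Fin 2)

/-- The induced basis `e i ⊗ e j` of `V ⊗ V`. -/
noncomputable def VVbasis : Module.Basis (Fin 2 × Fin 2) K (V ⊗[K] V) :=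
  Vbasis.tensorProduct Vbasis

/-- Kauffman amplitude of `Cup`: `1 ↦ -q·e₀⊗e₁ + q⁻¹·e₁⊗e₀`. -/
noncomputable def Cup : K →ₗ[K] V ⊗[K] V :=
  LinearMap.toSpanSingleton K (V ⊗[K] V)
    ((-q) • (e 0 ⊗ₜ[K] e 1) + q⁻¹ • (e 1 ⊗ₜ[K] e 0))

/-- Kauffman amplitude of `Cap`: `e₀⊗e₀ ↦ 0`, `e₁⊗e₁ ↦ 0`, `e₀⊗e₁ ↦ q`, `e₁⊗e₀ ↦ -q⁻¹`. -/
noncomputable def Cap : V ⊗[K] V →ₗ[K] K :=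
  VVbasis.constr K fun p =>
    if p = (0, 1) then q else if p = (1, 0) then -q⁻¹ else 0

/-- Kauffman amplitude of `NE`. -/
noncomputable def NE : V ⊗[K] V →ₗ[K] V ⊗[K] V :=
  VVbasis.constr K fun p =>
    if p = (0, 0) then q • (e 0 ⊗ₜ[K] e 0)
    else if p = (1, 1) then q • (e 1 ⊗ₜ[K] e 1)
    else if p = (0, 1) then q⁻¹ • (e 1 ⊗ₜ[K] e 0)
    else q⁻¹ • (e 0 ⊗ₜ[K] e 1) + (q - q⁻¹ ^ 3) • (e 1 ⊗ₜ[K] e 0)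

/-- Kauffman amplitude of `NW`. -/
noncomputable def NW : V ⊗[K] V →ₗ[K] V ⊗[K] V :=
  VVbasis.constr K fun p =>
    if p = (0, 0) then q⁻¹ • (e 0 ⊗ₜ[K] e 0)
    else if p = (1, 1) then q⁻¹ • (e 1 ⊗ₜ[K] e 1)
    else if p = (1, 0) then q • (e 0 ⊗ₜ[K] e 1)
    else (q⁻¹ - q ^ 3) • (e 0 ⊗ₜ[K] e 1) + q • (e 1 ⊗ₜ[K] e 0)

theorem VVbasis_apply (i j : Fin 2) : VVbasis (i, j) = e i ⊗ₜ[K] e j := by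
  simp [VVbasis, Vbasis, e, Module.Basis.tensorProduct_apply]

theorem Cap_apply (i j : Fin 2) : Cap (e i ⊗ₜ[K] e j) =
    if (i, j) = ((0, 1) : Fin 2 × Fin 2) then q
    else if (i, j) = ((1, 0) : Fin 2 × Fin 2) then -q⁻¹ else 0 := by
  rw [← VVbasis_apply, Cap, Module.Basis.constr_basis]

theorem NE_apply (i j : Fin 2) : NE (e i ⊗ₜ[K] e j) =
    if (i, j) = ((0, 0) : Fin 2 × Fin 2) then q • (e 0 ⊗ₜ[K] e 0)
    else if (i, j) = ((1, 1) : Fin 2 × Fin 2) then q • (e 1 ⊗ₜ[K] e 1)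
    else if (i, j) = ((0, 1) : Fin 2 × Fin 2) then q⁻¹ • (e 1 ⊗ₜ[K] e 0)
    else q⁻¹ • (e 0 ⊗ₜ[K] e 1) + (q - q⁻¹ ^ 3) • (e 1 ⊗ₜ[K] e 0) := by
  rw [← VVbasis_apply, NE, Module.Basis.constr_basis]

theorem NW_apply (i j : Fin 2) : NW (e i ⊗ₜ[K] e j) =
    if (i, j) = ((0, 0) : Fin 2 × Fin 2) then q⁻¹ • (e 0 ⊗ₜ[K] e 0)
    else if (i, j) = ((1, 1) : Fin 2 × Fin 2) then q⁻¹ • (e 1 ⊗ₜ[K] e 1)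
    else if (i, j) = ((1, 0) : Fin 2 × Fin 2) then q • (e 0 ⊗ₜ[K] e 1)
    else (q⁻¹ - q ^ 3) • (e 0 ⊗ₜ[K] e 1) + q • (e 1 ⊗ₜ[K] e 0) := by
  rw [← VVbasis_apply, NW, Module.Basis.constr_basis]

theorem q_ne : q ≠ 0 := RatFunc.X_ne_zero

/-- Yetter Ψ move, time-reversed flavor (ET4t):
`(⟨Cap⟩ ⊗ id_V) ∘ (id_V ⊗ ⟨NE⟩) = (id_V ⊗ ⟨Cap⟩) ∘ (⟨NW⟩ ⊗ id_V)` as maps `(V ⊗ V) ⊗ V → V`. -/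
theorem yetter_psi_ET4t :
    (TensorProduct.lid K V).toLinearMap ∘ₗ
        TensorProduct.map Cap (LinearMap.id : V →ₗ[K] V) ∘ₗ
        (TensorProduct.assoc K V V V).symm.toLinearMap ∘ₗ
        TensorProduct.map (LinearMap.id : V →ₗ[K] V) NE ∘ₗ
        (TensorProduct.assoc K V V V).toLinearMap
      =
      (TensorProduct.rid K V).toLinearMap ∘ₗ
        TensorProduct.map (LinearMap.id : V →ₗ[K] V) Cap ∘ₗ
        (TensorProduct.assoc K V V V).toLinearMap ∘ₗ
        TensorProduct.map NW (LinearMap.id : V →ₗ[K] V) := by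
  have hq := q_ne
  refine (VVbasis.tensorProduct Vbasis).ext ?_
  rintro ⟨⟨i, j⟩, k⟩
  have hk : Vbasis k = e k := by simp [Vbasis, e]
  rw [Module.Basis.tensorProduct_apply, VVbasis_apply, hk]
  simp only [LinearMap.comp_apply, LinearEquiv.coe_coe, TensorProduct.map_tmul,
    TensorProduct.assoc_tmul, LinearMap.id_apply, NE_apply, NW_apply]
  fin_cases i <;> fin_cases j <;> fin_cases k <;>
    simp [TensorProduct.tmul_add, TensorProduct.add_tmul, TensorProduct.tmul_smul,
      ← TensorProduct.smul_tmul', Cap_apply, smul_smul, hq] <;>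
    (try (rw [← neg_smul]; congr 1; field_simp; try ring))
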